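/- arXiv:2510.25699 — 2 statements merged into one kernel-verified Lean document; each statement's English description precedes it below -/
import Mathlib

section
/- Let X₀, …, Xₙ be n+1 affinely independent points in ℝⁿ, let S = convexHull{X₀, …, Xₙ} with diameter h, and let f : ℝⁿ → ℝ be twice continuously differentiable on an open set containing S with the operator norm of its second derivative bounded by M on S. Then for every p ∈ S, with λ₀, …, λₙ the barycentric coordinates of p, the linear interpolation error satisfies |f(p) − Σᵢ₌₀ⁿ λᵢ f(Xᵢ)| ≤ (1/2) · M · h². -/
/-- Second-order Taylor bound: if the derivative of `f` is
differentiable on a convex set `s` and its derivative is bounded by `M` there, then `f` differs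
from its first-order expansion at `x` by at most `M / 2 * ‖y - x‖ ^ 2`. -/
theorem Convex.norm_sub_sub_fderiv_le {E F : Type*} [NormedAddCommGroup E] [NormedSpace ℝ E]
    [NormedAddCommGroup F] [NormedSpace ℝ F] {f : E → F} {s : Set E} {M : ℝ} {x y : E}
    (hs : Convex ℝ s) (hf : ∀ z ∈ s, DifferentiableAt ℝ f z)
    (hf' : ∀ z ∈ s, DifferentiableAt ℝ (fderiv ℝ f) z)
    (hM : ∀ z ∈ s, ‖fderiv ℝ (fderiv ℝ f) z‖ ≤ M) (hx : x ∈ s) (hy : y ∈ s) :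
    ‖f y - f x - fderiv ℝ f x (y - x)‖ ≤ M / 2 * ‖y - x‖ ^ 2 := by
  set v := y - x
  have hmem : ∀ t ∈ Set.Icc (0 : ℝ) 1, x + t • v ∈ s := fun t ht =>
    hs.add_smul_sub_mem hx hy ht
  have hderiv : ∀ t ∈ Set.Icc (0 : ℝ) 1, HasDerivAt
      (fun t : ℝ => f (x + t • v) - f x - t • fderiv ℝ f x v)
      (fderiv ℝ f (x + t • v) v - fderiv ℝ f x v) t := by
    intro t ht
    have hline : HasDerivAt (fun t : ℝ => x + t • v) v t := by
      simpa using ((hasDerivAt_id t).smul_const v).const_add x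
    have hlin : HasDerivAt (fun t : ℝ => t • fderiv ℝ f x v) (fderiv ℝ f x v) t := by
      simpa using (hasDerivAt_id t).smul_const (fderiv ℝ f x v)
    exact (((hf _ (hmem t ht)).hasFDerivAt.comp_hasDerivAt t hline).sub_const (f x)).sub hlin
  have hB : ∀ t : ℝ, HasDerivAt (fun t : ℝ => M / 2 * ‖v‖ ^ 2 * t ^ 2) (M * ‖v‖ ^ 2 * t) t := by
    intro t
    refine ((hasDerivAt_pow 2 t).const_mul (M / 2 * ‖v‖ ^ 2)).congr_deriv ?_
    norm_num
    ring
  have hbound : ∀ t ∈ Set.Ico (0 : ℝ) 1,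
      ‖fderiv ℝ f (x + t • v) v - fderiv ℝ f x v‖ ≤ M * ‖v‖ ^ 2 * t := by
    intro t ht
    have hlip : ‖fderiv ℝ f (x + t • v) - fderiv ℝ f x‖ ≤ M * ‖x + t • v - x‖ :=
      hs.norm_image_sub_le_of_norm_fderiv_le hf' hM hx (hmem t (Set.Ico_subset_Icc_self ht))
    rw [add_sub_cancel_left, norm_smul, Real.norm_of_nonneg ht.1] at hlip
    calc ‖fderiv ℝ f (x + t • v) v - fderiv ℝ f x v‖
        ≤ ‖fderiv ℝ f (x + t • v) - fderiv ℝ f x‖ * ‖v‖ :=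
          (fderiv ℝ f (x + t • v) - fderiv ℝ f x).le_opNorm v
      _ ≤ M * (t * ‖v‖) * ‖v‖ := by gcongr
      _ = M * ‖v‖ ^ 2 * t := by ring
  have key := image_norm_le_of_norm_deriv_right_le_deriv_boundary
    (fun t ht => (hderiv t ht).continuousAt.continuousWithinAt)
    (fun t ht => (hderiv t (Set.Ico_subset_Icc_self ht)).hasDerivWithinAt)
    (by simp) hB hbound (Set.right_mem_Icc.2 zero_le_one)
  simpa [v] using key

/-- Barycentric coordinates of a point of a simplex are nonnegative. -/
theorem AffineIndependent.nonneg_of_sum_smul_mem_convexHull {ι E : Type*} [Fintype ι]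
    [AddCommGroup E] [Module ℝ E] {X : ι → E} (hX : AffineIndependent ℝ X) {w : ι → ℝ}
    (hw : ∑ i, w i = 1) (hmem : ∑ i, w i • X i ∈ convexHull ℝ (Set.range X)) (i : ι) :
    0 ≤ w i := by
  rw [convexHull_range_eq_exists_affineCombination] at hmem
  obtain ⟨s, u, hu, hu1, hux⟩ := hmem
  rw [← Finset.affineCombination_eq_linear_combination _ _ _ hw] at hux
  have h := (affineIndependent_iff_indicator_eq_of_affineCombination_eq ℝ X).1 hX
    s Finset.univ u w hu1 hw hux
  have hi := congrFun h i
  rw [Finset.coe_univ, Set.indicator_univ] at hi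
  rw [← hi]
  exact Set.indicator_nonneg hu i

/-- Quadratic interpolation error bound: let `S` be the simplex spanned by `n+1`
affinely independent points in `ℝⁿ` with diameter `h`, and let `f` be twice
continuously differentiable on an open set containing `S`, with the operator
norm of its second derivative bounded by `M` on `S`.  Then for every `p ∈ S`
with barycentric coordinates `λ₀, …, λₙ`, the barycentric linear interpolation
error satisfies `|f p - ∑ᵢ λᵢ f Xᵢ| ≤ (1/2) * M * h ^ 2`. -/
theorem barycentric_interpolation_error_le_of_contDiff
    (n : ℕ) (X : Fin (n + 1) → EuclideanSpace ℝ (Fin n)) (hX : AffineIndependent ℝ X)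
    (f : EuclideanSpace ℝ (Fin n) → ℝ)
    (U : Set (EuclideanSpace ℝ (Fin n))) (hU : IsOpen U)
    (hSU : convexHull ℝ (Set.range X) ⊆ U)
    (hf : ContDiffOn ℝ 2 f U)
    (M : ℝ)
    (hM : ∀ x ∈ convexHull ℝ (Set.range X), ‖iteratedFDeriv ℝ 2 f x‖ ≤ M)
    (p : EuclideanSpace ℝ (Fin n)) (hp : p ∈ convexHull ℝ (Set.range X))
    (lam : Fin (n + 1) → ℝ)
    (hsum : (∑ i : Fin (n + 1), lam i) = 1)
    (hpt : (∑ i : Fin (n + 1), lam i • X i) = p) :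
    |f p - ∑ i : Fin (n + 1), lam i * f (X i)| ≤
      (1 / 2) * M * (Metric.diam (convexHull ℝ (Set.range X))) ^ 2 := by
  have hlam : ∀ i, 0 ≤ lam i := hX.nonneg_of_sum_smul_mem_convexHull hsum (hpt ▸ hp)
  have hC2 : ∀ z ∈ convexHull ℝ (Set.range X), ContDiffAt ℝ 2 f z := fun z hz =>
    hf.contDiffAt (hU.mem_nhds (hSU hz))
  have hM0 : 0 ≤ M := (norm_nonneg _).trans (hM p hp)
  have hbdd : Bornology.IsBounded (convexHull ℝ (Set.range X)) :=
    isBounded_convexHull.2 (Set.finite_range X).isBounded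
  have hvert : ∀ i, ‖f (X i) - f p - fderiv ℝ f p (X i - p)‖ ≤
      (1 / 2) * M * (Metric.diam (convexHull ℝ (Set.range X))) ^ 2 := by
    intro i
    have hXi : X i ∈ convexHull ℝ (Set.range X) := subset_convexHull ℝ _ (Set.mem_range_self i)
    have hdist : ‖X i - p‖ ≤ Metric.diam (convexHull ℝ (Set.range X)) := by
      rw [← dist_eq_norm]
      exact Metric.dist_le_diam_of_mem hbdd hXi hp
    calc ‖f (X i) - f p - fderiv ℝ f p (X i - p)‖ ≤ M / 2 * ‖X i - p‖ ^ 2 := by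
          refine (convex_convexHull ℝ (Set.range X)).norm_sub_sub_fderiv_le
            (fun z hz => (hC2 z hz).differentiableAt (by norm_num))
            (fun z hz => ((hC2 z hz).fderiv_right (m := 1) (by norm_num)).differentiableAt
              (by norm_num))
            (fun z hz => ?_) hp hXi
          rw [← norm_iteratedFDeriv_one, norm_iteratedFDeriv_fderiv]
          exact hM z hz
      _ ≤ M / 2 * (Metric.diam (convexHull ℝ (Set.range X))) ^ 2 := by gcongr
      _ = (1 / 2) * M * (Metric.diam (convexHull ℝ (Set.range X))) ^ 2 := by ring
  have hlinear : ∑ i, lam i * fderiv ℝ f p (X i - p) = 0 := by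
    calc ∑ i, lam i * fderiv ℝ f p (X i - p) = fderiv ℝ f p (∑ i, lam i • (X i - p)) := by
          simp only [map_sum, map_smul, smul_eq_mul]
      _ = 0 := by simp [smul_sub, Finset.sum_sub_distrib, ← Finset.sum_smul, hsum, hpt]
  have herror : ∑ i, lam i * f (X i) - f p =
      ∑ i, lam i * (f (X i) - f p - fderiv ℝ f p (X i - p)) := by
    simp only [mul_sub, Finset.sum_sub_distrib, ← Finset.sum_mul, hsum, hlinear]
    ring
  rw [abs_sub_comm, herror]
  calc |∑ i, lam i * (f (X i) - f p - fderiv ℝ f p (X i - p))|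
      ≤ ∑ i, |lam i * (f (X i) - f p - fderiv ℝ f p (X i - p))| :=
        Finset.abs_sum_le_sum_abs _ _
    _ ≤ ∑ i, lam i * ((1 / 2) * M * (Metric.diam (convexHull ℝ (Set.range X))) ^ 2) := by
        refine Finset.sum_le_sum fun i _ => ?_
        rw [abs_mul, abs_of_nonneg (hlam i)]
        exact mul_le_mul_of_nonneg_left (hvert i) (hlam i)
    _ = (1 / 2) * M * (Metric.diam (convexHull ℝ (Set.range X))) ^ 2 := by
        rw [← Finset.sum_mul, hsum, one_mul]
end

section
/- Fix n ≥ 1 and n+1 affinely independent points X₁, …, X_{n+1} in ℝⁿ spanning the simplex S = convexHull{X₁, …, X_{n+1}}. Define T : (0,1)ⁿ → ℝⁿ as follows: given z = (z₁, …, zₙ), set λⱼ = zⱼ^{1/(n+1−j)} for j = 1, …, n, set λ₀ = 1 and λ_{n+1} = 0, and let T(z) = Σᵢ₌₁^{n+1} (1 − λᵢ) · (∏ⱼ₌₀^{i−1} λⱼ) · Xᵢ. Then the pushforward under T of the uniform probability measure on the cube (0,1)ⁿ is the uniform probability measure on S, i.e. Lebesgue measure restricted to S and normalized by vol(S). -/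
open MeasureTheory

/-- The uniform probability measure on a set `s` of positive finite Lebesgue
measure: Lebesgue measure restricted to `s`, normalized by the measure of `s`. -/
noncomputable def uniformProbOn {ι : Type*} [Fintype ι] (s : Set (ι → ℝ)) :
    Measure (ι → ℝ) :=
  (volume s)⁻¹ • volume.restrict s

/-- The partial products `z₀ ^ (1 / n) * ⋯ * zᵢ ^ (1 / (n - i))`. -/
noncomputable def rootProd {n : ℕ} (z : Fin n → ℝ) (i : Fin n) : ℝ :=
  ∏ j ∈ Finset.Iic i, z j ^ (1 / ((n : ℝ) - (j : ℕ)))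

/-- The Jacobian matrix of `rootProd` at a point with positive coordinates. -/
noncomputable def rootProdJacobian {n : ℕ} (z : Fin n → ℝ) : Matrix (Fin n) (Fin n) ℝ :=
  Matrix.of fun i j => if j ≤ i then rootProd z i * (1 / ((n : ℝ) - (j : ℕ))) / z j else 0

lemma hasFDerivAt_rootProd {n : ℕ} {z : Fin n → ℝ} (hz : ∀ j, 0 < z j) :
    HasFDerivAt rootProd (Matrix.toLin' (rootProdJacobian z)).toContinuousLinearMap z := by
  rw [hasFDerivAt_pi']
  intro i
  have hpow : ∀ j ∈ Finset.Iic i, HasFDerivAt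
      (fun x : Fin n → ℝ => x j ^ (1 / ((n : ℝ) - (j : ℕ)))) _ z :=
    fun j _ => (hasFDerivAt_apply j z).rpow_const (Or.inl (hz j).ne')
  refine (HasFDerivAt.finsetProd hpow).congr_fderiv ?_
  ext v
  simp only [sum_apply, smul_apply,
    ContinuousLinearMap.comp_apply, ContinuousLinearMap.proj_apply,
    LinearMap.coe_toContinuousLinearMap', Matrix.toLin'_apply, Matrix.mulVec, dotProduct,
    rootProdJacobian, Matrix.of_apply, smul_eq_mul, ite_mul, zero_mul]
  rw [← Finset.sum_filter]
  have hfilter : Finset.univ.filter (· ≤ i) = Finset.Iic i := by ext; simp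
  rw [hfilter]
  refine Finset.sum_congr rfl fun j hj => ?_
  rw [rootProd, ← Finset.mul_prod_erase _ _ hj, Real.rpow_sub_one (hz j).ne']
  ring

lemma prod_rootProd {n : ℕ} {z : Fin n → ℝ} (hz : ∀ j, 0 < z j) :
    ∏ i, rootProd z i = ∏ i, z i := by
  unfold rootProd
  rw [Finset.prod_comm' (t' := Finset.univ) (s' := fun j => Finset.Ici j) (by simp)]
  refine Finset.prod_congr rfl fun j _ => ?_
  have hj : (0 : ℝ) < (n : ℝ) - (j : ℕ) := by
    have : ((j : ℕ) : ℝ) < n := by exact_mod_cast j.2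
    linarith
  rw [Finset.prod_const, Fin.card_Ici, ← Real.rpow_natCast, ← Real.rpow_mul (hz j).le,
    Nat.cast_sub j.2.le, one_div_mul_cancel hj.ne', Real.rpow_one]

lemma det_rootProdJacobian {n : ℕ} {z : Fin n → ℝ} (hz : ∀ j, 0 < z j) :
    (rootProdJacobian z).det = ∏ i : Fin n, 1 / ((n : ℝ) - (i : ℕ)) := by
  rw [Matrix.det_of_isLowerTriangular]
  · simp only [rootProdJacobian, Matrix.of_apply, le_refl, if_true]
    rw [Finset.prod_div_distrib, Finset.prod_mul_distrib, prod_rootProd hz,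
      mul_div_cancel_left₀ _ (Finset.prod_pos fun i _ => hz i).ne']
  · intro i j hij
    have : ¬ j ≤ i := not_le.2 hij
    simp [rootProdJacobian, this]

lemma one_sub_mul_prod_range (l : ℕ → ℝ) (i : ℕ) :
    (1 - l (i + 1)) * ∏ j ∈ Finset.range (i + 1), l j =
      ∏ j ∈ Finset.range (i + 1), l j - ∏ j ∈ Finset.range (i + 2), l j := by
  rw [Finset.prod_range_succ _ (i + 1)]
  ring

/-- Stick-breaking weights sum to one. -/
lemma sum_one_sub_mul_prod_range {n : ℕ} {l : ℕ → ℝ} (h0 : l 0 = 1) (hn : l (n + 1) = 0) :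
    ∑ i : Fin (n + 1), (1 - l ((i : ℕ) + 1)) * ∏ j ∈ Finset.range ((i : ℕ) + 1), l j = 1 := by
  simp only [one_sub_mul_prod_range]
  rw [Fin.sum_univ_eq_sum_range
    (fun i => ∏ j ∈ Finset.range (i + 1), l j - ∏ j ∈ Finset.range (i + 2), l j) (n + 1),
    Finset.sum_range_sub' (fun i => ∏ j ∈ Finset.range (i + 1), l j),
    Finset.prod_range_succ _ (n + 1)]
  simp [h0, hn]

/-- Stick-breaking weights determine the stick-breaking proportions. -/
lemma eq_of_one_sub_mul_prod_range_eq {n : ℕ} {l m : ℕ → ℝ} (hl0 : l 0 = 1) (hm0 : m 0 = 1)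
    (hl : ∀ j < n, l (j + 1) ≠ 0)
    (h : ∀ i < n, (1 - l (i + 1)) * ∏ j ∈ Finset.range (i + 1), l j =
      (1 - m (i + 1)) * ∏ j ∈ Finset.range (i + 1), m j) :
    ∀ j < n, l (j + 1) = m (j + 1) := by
  have hprod : ∀ i ≤ n,
      ∏ j ∈ Finset.range (i + 1), l j = ∏ j ∈ Finset.range (i + 1), m j := by
    intro i
    induction i with
    | zero => simp [hl0, hm0]
    | succ i ih =>
      intro hi
      have hw := h i hi
      rw [one_sub_mul_prod_range, one_sub_mul_prod_range, ih (by omega)] at hw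
      linarith
  intro j hj
  have hne : ∏ k ∈ Finset.range (j + 1), l k ≠ 0 := by
    rw [Finset.prod_range_succ', hl0, mul_one, Finset.prod_ne_zero_iff]
    intro k hk
    exact hl k (by have := Finset.mem_range.1 hk; omega)
  have hw := h j hj
  rw [← hprod j hj.le] at hw
  have := mul_right_cancel₀ hne hw
  linarith

/-- Positive weights summing to one arise by stick breaking with the ratios of their tails. -/
lemma exists_one_sub_mul_prod_range_eq {n : ℕ} {w : Fin (n + 1) → ℝ} (hw : ∀ i, 0 < w i)
    (hsum : ∑ i, w i = 1) :
    ∃ r : ℕ → ℝ, (∀ j < n, r j ∈ Set.Ioo (0 : ℝ) 1) ∧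
      ∀ l : ℕ → ℝ, l 0 = 1 → l (n + 1) = 0 → (∀ j < n, l (j + 1) = r j) →
        ∀ i : Fin (n + 1),
          (1 - l ((i : ℕ) + 1)) * ∏ j ∈ Finset.range ((i : ℕ) + 1), l j = w i := by
  set v : ℕ → ℝ := fun k => if h : k < n + 1 then w ⟨k, h⟩ else 0 with hv
  set R : ℕ → ℝ := fun i => ∑ k ∈ Finset.Ico i (n + 1), v k with hR
  have hvpos : ∀ k < n + 1, 0 < v k := fun k hk => by simp only [hv, hk, dif_pos]; exact hw _
  have hvw : ∀ i : Fin (n + 1), v i = w i := fun i => dif_pos i.2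
  have hstep : ∀ i < n + 1, R i = v i + R (i + 1) := fun i hi =>
    Finset.sum_eq_sum_Ico_succ_bot hi v
  have hR0 : R 0 = 1 := by
    simp only [hR, Nat.Ico_zero_eq_range]
    rw [← Fin.sum_univ_eq_sum_range, ← hsum]
    exact Finset.sum_congr rfl fun i _ => hvw i
  have hRtop : R (n + 1) = 0 := by simp [hR]
  have hRpos : ∀ i < n + 1, 0 < R i := fun i hi => by
    refine Finset.sum_pos (fun k hk => hvpos k (Finset.mem_Ico.1 hk).2) ?_
    simpa using hi
  refine ⟨fun j => R (j + 1) / R j, fun j hj => ?_, fun l h0 htop hl => ?_⟩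
  · have h1 := hRpos j (by omega)
    refine ⟨div_pos (hRpos _ (by omega)) h1, (div_lt_one h1).2 ?_⟩
    rw [hstep j (by omega)]
    linarith [hvpos j (by omega)]
  · have hprod : ∀ i ≤ n, ∏ j ∈ Finset.range (i + 1), l j = R i := by
      intro i
      induction i with
      | zero => simp [h0, hR0]
      | succ i ih =>
        intro hi
        rw [Finset.prod_range_succ, ih (by omega), hl i hi,
          mul_div_cancel₀ _ (hRpos i (by omega)).ne']
    intro i
    have hi : (i : ℕ) < n + 1 := i.2
    rw [hprod i (by omega), ← hvw i]
    rcases (Nat.lt_succ_iff.1 hi).lt_or_eq with hlt | heq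
    · rw [hl i hlt, sub_mul, div_mul_cancel₀ _ (hRpos i hi).ne', hstep i hi]
      ring
    · rw [heq, htop, hstep n (by omega), hRtop]
      ring

/-- Summation by parts for stick-breaking combinations. -/
lemma sum_one_sub_mul_prod_range_smul {n : ℕ} {E : Type*} [AddCommGroup E] [Module ℝ E]
    {l : ℕ → ℝ} (h0 : l 0 = 1) (hn : l (n + 1) = 0) (X : Fin (n + 1) → E) :
    ∑ i : Fin (n + 1), ((1 - l ((i : ℕ) + 1)) * ∏ j ∈ Finset.range ((i : ℕ) + 1), l j) • X i =
      X 0 + ∑ i : Fin n,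
        (∏ j ∈ Finset.range ((i : ℕ) + 2), l j) • (X i.succ - X i.castSucc) := by
  simp only [one_sub_mul_prod_range, sub_smul, smul_sub, Finset.sum_sub_distrib]
  rw [Fin.sum_univ_succ, Fin.sum_univ_castSucc (n := n)
    (f := fun i => (∏ j ∈ Finset.range ((i : ℕ) + 2), l j) • X i)]
  have htop : ∏ j ∈ Finset.range (n + 2), l j = 0 :=
    Finset.prod_eq_zero (Finset.mem_range.2 (Nat.lt_succ_self (n + 1))) hn
  simp [h0, htop, add_sub_assoc]

lemma prod_range_eq_rootProd {n : ℕ} {l : ℕ → ℝ} {z : Fin n → ℝ} (h0 : l 0 = 1)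
    (hl : ∀ j : Fin n, l ((j : ℕ) + 1) = z j ^ (1 / ((n : ℝ) - (j : ℕ)))) (i : Fin n) :
    ∏ j ∈ Finset.range ((i : ℕ) + 2), l j = rootProd z i := by
  rw [Finset.prod_range_succ', h0, mul_one, Nat.range_succ_eq_Iic, ← Fin.map_valEmbedding_Iic,
    Finset.prod_map]
  exact Finset.prod_congr rfl fun j _ => hl j

/-- An injective map with constant Jacobian determinant that carries `s` into a bounded convex set
`t` and covers the interior of `t` pushes the uniform measure on `s` to the uniform measure
on `t`. -/
lemma map_uniformProbOn_of_abs_det_eq {ι : Type*} [Fintype ι] {s t : Set (ι → ℝ)}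
    {f : (ι → ℝ) → ι → ℝ} {f' : (ι → ℝ) → (ι → ℝ) →L[ℝ] (ι → ℝ)} {d : ℝ}
    (hs : MeasurableSet s) (hf : Measurable f) (hf' : ∀ x ∈ s, HasFDerivAt f (f' x) x)
    (hdet : ∀ x ∈ s, |(f' x).det| = d) (hinj : Set.InjOn f s)
    (ht : Convex ℝ t) (htb : Bornology.IsBounded t) (hti : (interior t).Nonempty)
    (hmaps : Set.MapsTo f s t) (hsurj : interior t ⊆ f '' s) :
    Measure.map f (uniformProbOn s) = uniformProbOn t := by
  have hcov := map_withDensity_abs_det_fderiv_eq_addHaar volume hs.nullMeasurableSet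
    (fun x hx => (hf' x hx).hasFDerivWithinAt) hinj
  have hdens : (volume.restrict s).withDensity (fun x => ENNReal.ofReal |(f' x).det|) =
      ENNReal.ofReal d • volume.restrict s := by
    rw [← withDensity_const]
    refine withDensity_congr_ae ?_
    filter_upwards [ae_restrict_mem hs] with x hx
    rw [hdet x hx]
  have himage : f '' s =ᵐ[volume] t := by
    refine (LE.le.eventuallyLE hmaps.image_subset).antisymm ?_
    refine Filter.EventuallyLE.trans ?_ (LE.le.eventuallyLE hsurj)
    rw [ae_le_set]
    refine measure_mono_null ?_ (ht.addHaar_frontier volume)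
    exact Set.sdiff_subset_sdiff_left subset_closure
  rw [hdens, Measure.map_smul, Measure.restrict_congr_set himage] at hcov
  have hmass : ENNReal.ofReal d * volume s = volume t := by
    have := congrArg (fun μ => μ Set.univ) hcov
    simpa [Measure.map_apply hf MeasurableSet.univ] using this
  have ht0 : volume t ≠ 0 :=
    ((isOpen_interior.measure_pos volume hti).trans_le (measure_mono interior_subset)).ne'
  have htt : volume t ≠ ⊤ := htb.measure_lt_top.ne
  have hd0 : ENNReal.ofReal d ≠ 0 := fun h => ht0 (by rw [← hmass, h, zero_mul])
  rw [uniformProbOn, uniformProbOn, Measure.map_smul, ← hcov, smul_smul, ← hmass,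
    ENNReal.mul_inv (Or.inl hd0) (Or.inl ENNReal.ofReal_ne_top), mul_right_comm,
    ENNReal.inv_mul_cancel hd0 ENNReal.ofReal_ne_top, one_mul]

/-- The root-of-uniform recursion produces uniform points in a simplex.  Given
`n ≥ 1` and `n+1` affinely independent points `X 1, …, X (n+1)` in `ℝⁿ` (here
`X i` for `i : Fin (n+1)` denotes the paper's `X (i+1)`), define for
`z ∈ (0,1)ⁿ` the coordinates `λ₀ = 1`, `λⱼ = zⱼ ^ (1/(n+1-j))` for
`j = 1, …, n`, `λ_{n+1} = 0`, and
`T z = ∑_{i=1}^{n+1} (1 - λᵢ) (∏_{j=0}^{i-1} λⱼ) • Xᵢ`.  Then the pushforward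
under `T` of the uniform probability measure on the cube `(0,1)ⁿ` is the
uniform probability measure on the simplex `convexHull {X 1, …, X (n+1)}`. -/
theorem map_uniform_cube_eq_uniform_simplex
    (n : ℕ) (hn : 1 ≤ n)
    (X : Fin (n + 1) → (Fin n → ℝ)) (hX : AffineIndependent ℝ X)
    (lam : (Fin n → ℝ) → ℕ → ℝ)
    (hlam0 : ∀ z, lam z 0 = 1)
    (hlamj : ∀ z, ∀ j : Fin n, lam z ((j : ℕ) + 1) =
      (z j) ^ ((1 : ℝ) / ((n : ℝ) + 1 - ((j : ℕ) + 1 : ℕ))))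
    (hlamTop : ∀ z, lam z (n + 1) = 0)
    (T : (Fin n → ℝ) → (Fin n → ℝ))
    (hT : ∀ z, T z = ∑ i : Fin (n + 1),
      ((1 - lam z ((i : ℕ) + 1)) * ∏ j ∈ Finset.range ((i : ℕ) + 1), lam z j) • X i) :
    Measure.map T (uniformProbOn (Set.univ.pi fun _ : Fin n => Set.Ioo (0 : ℝ) 1)) =
      uniformProbOn (convexHull ℝ (Set.range X)) := by
  have hlam : ∀ z, ∀ j : Fin n, lam z ((j : ℕ) + 1) = z j ^ (1 / ((n : ℝ) - (j : ℕ))) := by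
    intro z j
    rw [hlamj]
    congr 2
    push_cast
    ring
  have hexp : ∀ j : Fin n, (0 : ℝ) < (n : ℝ) - (j : ℕ) := fun j => by
    have : ((j : ℕ) : ℝ) < n := by exact_mod_cast j.2
    linarith
  set B : Matrix (Fin n) (Fin n) ℝ := Matrix.of fun k i => X i.succ k - X i.castSucc k with hB
  have hTB : T = fun z => X 0 + Matrix.toLin' B (rootProd z) := by
    funext z
    rw [hT, sum_one_sub_mul_prod_range_smul (hlam0 z) (hlamTop z)]
    congr 1
    ext k
    simp only [prod_range_eq_rootProd (hlam0 z) (hlam z), Finset.sum_apply, Pi.smul_apply,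
      Pi.sub_apply, smul_eq_mul, Matrix.toLin'_apply, Matrix.mulVec, dotProduct, hB,
      Matrix.of_apply]
    exact Finset.sum_congr rfl fun i _ => mul_comm _ _
  have hspan : affineSpan ℝ (Set.range X) = ⊤ :=
    hX.affineSpan_eq_top_iff_card_eq_finrank_add_one.2 (by simp)
  let b : AffineBasis (Fin (n + 1)) ℝ (Fin n → ℝ) := ⟨X, hX, hspan⟩
  have hpos : ∀ z ∈ Set.univ.pi fun _ : Fin n => Set.Ioo (0 : ℝ) 1, ∀ j, 0 < z j :=
    fun z hz j => (hz j trivial).1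
  refine map_uniformProbOn_of_abs_det_eq (d := |(B.det * ∏ i : Fin n, 1 / ((n : ℝ) - (i : ℕ)))|)
    (f' := fun z => (Matrix.toLin' B).toContinuousLinearMap ∘L
      (Matrix.toLin' (rootProdJacobian z)).toContinuousLinearMap)
    (MeasurableSet.univ_pi fun _ => measurableSet_Ioo) ?_ ?_ ?_ ?_ (convex_convexHull ℝ _)
    (isBounded_convexHull.2 (Set.finite_range X).isBounded)
    (interior_convexHull_nonempty_iff_affineSpan_eq_top.2 hspan) ?_ ?_
  · rw [hTB]
    have hroot : Measurable (rootProd (n := n)) := by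
      unfold rootProd
      fun_prop
    exact ((Matrix.toLin' B).toContinuousLinearMap.measurable.comp hroot).const_add _
  · intro z hz
    rw [hTB]
    exact ((Matrix.toLin' B).toContinuousLinearMap.hasFDerivAt.comp z
      (hasFDerivAt_rootProd (hpos z hz))).const_add _
  · intro z hz
    change |LinearMap.det (Matrix.toLin' B ∘ₗ Matrix.toLin' (rootProdJacobian z))| = _
    rw [LinearMap.det_comp, LinearMap.det_toLin',
      LinearMap.det_toLin', det_rootProdJacobian (hpos z hz)]
  · intro z hz z' hz' h
    rw [hT, hT] at h
    have hs := sum_one_sub_mul_prod_range (hlam0 z) (hlamTop z)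
    have hs' := sum_one_sub_mul_prod_range (hlam0 z') (hlamTop z')
    have hw := (affineIndependent_iff_eq_of_fintype_affineCombination_eq ℝ X).1 hX _ _ hs hs'
      (by rwa [Finset.affineCombination_eq_linear_combination _ _ _ hs,
        Finset.affineCombination_eq_linear_combination _ _ _ hs'])
    have hl := eq_of_one_sub_mul_prod_range_eq (n := n) (hlam0 z) (hlam0 z')
      (fun j hj => by
        have := hlam z ⟨j, hj⟩
        rw [this]
        exact (Real.rpow_pos_of_pos (hpos z hz _) _).ne')
      (fun i hi => congrFun hw ⟨i, by omega⟩)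
    funext j
    have hj := hl j j.2
    rw [hlam, hlam] at hj
    exact (Real.rpow_left_inj (hpos z hz j).le (hpos z' hz' j).le
      (one_div_pos.2 (hexp j)).ne').1 hj
  · intro z hz
    have hl : ∀ j < n, lam z (j + 1) ∈ Set.Icc (0 : ℝ) 1 := fun j hj => by
      have := hlam z ⟨j, hj⟩
      rw [this]
      exact ⟨Real.rpow_nonneg (hpos z hz _).le _, Real.rpow_le_one (hpos z hz _).le
        (hz _ trivial).2.le (one_div_pos.2 (hexp _)).le⟩
    have hmem : ∀ j ≤ n + 1, lam z j ∈ Set.Icc (0 : ℝ) 1 := by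
      rintro (_ | j) hj
      · simp [hlam0]
      · rcases (Nat.succ_le_succ_iff.1 hj).lt_or_eq with hlt | rfl
        · exact hl j hlt
        · simp [hlamTop]
    rw [hT]
    refine (convex_convexHull ℝ _).sum_mem (fun i _ => ?_)
      (sum_one_sub_mul_prod_range (hlam0 z) (hlamTop z))
      (fun i _ => subset_convexHull ℝ _ (Set.mem_range_self i))
    refine mul_nonneg (sub_nonneg.2 (hmem _ (by omega)).2) (Finset.prod_nonneg fun j hj => ?_)
    exact (hmem j (by have := Finset.mem_range.1 hj; omega)).1
  · intro x hx
    have hcoord : ∀ i, 0 < b.coord i x := by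
      have := b.interior_convexHull
      exact this.subset hx
    obtain ⟨r, hr, hrw⟩ := exists_one_sub_mul_prod_range_eq hcoord (b.sum_coord_apply_eq_one x)
    let z : Fin n → ℝ := fun j => r j ^ ((n : ℝ) - (j : ℕ))
    have hlr : ∀ j < n, lam z (j + 1) = r j := fun j hj => by
      have := hlam z ⟨j, hj⟩
      rw [this, ← Real.rpow_mul (hr j hj).1.le, mul_one_div_cancel (hexp ⟨j, hj⟩).ne',
        Real.rpow_one]
    refine ⟨z, fun j _ => ⟨Real.rpow_pos_of_pos (hr j j.2).1 _,
      Real.rpow_lt_one (hr j j.2).1.le (hr j j.2).2 (hexp j)⟩, ?_⟩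
    rw [hT]
    simp only [hrw (lam z) (hlam0 z) (hlamTop z) hlr]
    exact b.linear_combination_coord_eq_self x
end
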